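/- arXiv:2508.05948 — 4 statements merged into one kernel-verified Lean document; each statement's English description precedes it below -/
import Mathlib

section
/- Let k ≥ 1 and let A_i, B_{i1}, …, B_{ik} ∈ ℂ^{m_i×n_i} for 1 ≤ i ≤ k. Then θ₁ equals the infimum, taken over all scalars λ_1, …, λ_k ∈ ℂ and unit vectors x_i ∈ ℂ^{n_i} (1 ≤ i ≤ k), of the quantity (Σ_{i=1}^k ‖A_i x_i − Σ_{s=1}^k λ_s B_{is} x_i‖₂²) / (1 + Σ_{s=1}^k |λ_s|²). -/
open scoped BigOperators
open Matrix

noncomputable section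

/-- Squared Frobenius norm of a complex matrix. -/
def frobSq {α β : Type} [Fintype α] [Fintype β] (M : Matrix α β ℂ) : ℝ :=
  ∑ i, ∑ j, ‖M i j‖ ^ 2

/-- Squared Euclidean norm of a complex vector. -/
def vecNormSq {α : Type} [Fintype α] (x : α → ℂ) : ℝ :=
  ∑ i, ‖x i‖ ^ 2

/-- Horizontal concatenation `[A, B 0, B 1, …, B (k-1)]`. -/
def hcat {m n k : ℕ} (A : Matrix (Fin m) (Fin n) ℂ)
    (B : Fin k → Matrix (Fin m) (Fin n) ℂ) :
    Matrix (Fin m) (Fin (k + 1) × Fin n) ℂ :=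
  Matrix.of fun i p => Fin.cases (A i p.2) (fun s => B s i p.2) p.1

theorem vecNormSq_nonneg {α : Type} [Fintype α] (x : α → ℂ) : 0 ≤ vecNormSq x :=
  Finset.sum_nonneg fun _ _ => sq_nonneg _

theorem frobSq_nonneg {α β : Type} [Fintype α] [Fintype β] (M : Matrix α β ℂ) :
    0 ≤ frobSq M :=
  Finset.sum_nonneg fun _ _ => Finset.sum_nonneg fun _ _ => sq_nonneg _

theorem vecNormSq_neg {α : Type} [Fintype α] (x : α → ℂ) : vecNormSq (-x) = vecNormSq x := by
  simp [vecNormSq]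

/-- The Frobenius norm is compatible with the Euclidean norm. -/
theorem vecNormSq_mulVec_le {α β : Type} [Fintype α] [Fintype β] (M : Matrix α β ℂ)
    (w : β → ℂ) : vecNormSq (M *ᵥ w) ≤ frobSq M * vecNormSq w := by
  unfold vecNormSq frobSq
  rw [Finset.sum_mul]
  refine Finset.sum_le_sum fun i _ => ?_
  calc ‖(M *ᵥ w) i‖ ^ 2 ≤ (∑ j, ‖M i j‖ * ‖w j‖) ^ 2 := by
        gcongr
        simpa [Matrix.mulVec, dotProduct] using
          norm_sum_le Finset.univ fun j => M i j * w j
    _ ≤ _ := Finset.sum_mul_sq_le_sq_mul_sq _ _ _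

theorem frobSq_smul_vecMulVec_star {α β : Type} [Fintype α] [Fintype β] (c : ℂ)
    (r : α → ℂ) (w : β → ℂ) :
    frobSq (c • vecMulVec r (star w)) = ‖c‖ ^ 2 * (vecNormSq r * vecNormSq w) := by
  unfold frobSq vecNormSq
  rw [Finset.sum_mul_sum]
  simp only [Finset.mul_sum, Matrix.smul_apply, vecMulVec_apply, Pi.star_apply, smul_eq_mul,
    norm_mul, norm_star, mul_pow]

theorem smul_vecMulVec_star_mulVec {α β : Type} [Fintype β] (c : ℂ)
    (r : α → ℂ) (w : β → ℂ) :
    (c • vecMulVec r (star w)) *ᵥ w = (c * (vecNormSq w : ℂ)) • r := by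
  have h : star w ⬝ᵥ w = (vecNormSq w : ℂ) := by
    simp [dotProduct, vecNormSq, Complex.conj_mul']
  rw [Matrix.smul_mulVec, Matrix.vecMulVec_mulVec, h]
  ext i
  simp [mul_comm, mul_left_comm]

/-- The tensor product of `(1, -λ)` with `x`. -/
def pencilVec {n k : ℕ} (lam : Fin k → ℂ) (x : Fin n → ℂ) : Fin (k + 1) × Fin n → ℂ :=
  fun p => Fin.cases (motive := fun _ => ℂ) 1 (fun s => -lam s) p.1 * x p.2

theorem vecNormSq_pencilVec {n k : ℕ} (lam : Fin k → ℂ) (x : Fin n → ℂ) :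
    vecNormSq (pencilVec lam x) = (1 + ∑ s, ‖lam s‖ ^ 2) * vecNormSq x := by
  simp [vecNormSq, pencilVec, Fintype.sum_prod_type, Fin.sum_univ_succ, mul_pow, add_mul,
    Finset.sum_mul_sum]

theorem hcat_mulVec_pencilVec {m n k : ℕ} (A : Matrix (Fin m) (Fin n) ℂ)
    (B : Fin k → Matrix (Fin m) (Fin n) ℂ) (lam : Fin k → ℂ) (x : Fin n → ℂ) :
    hcat A B *ᵥ pencilVec lam x = A *ᵥ x - ∑ s, lam s • B s *ᵥ x := by
  ext i
  simp [Matrix.mulVec, dotProduct, hcat, pencilVec, Fintype.sum_prod_type,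
    Fin.sum_univ_succ, Finset.mul_sum, mul_left_comm, sub_eq_add_neg]

theorem hcat_sub {m n k : ℕ} (A A' : Matrix (Fin m) (Fin n) ℂ)
    (B B' : Fin k → Matrix (Fin m) (Fin n) ℂ) :
    hcat (A - A') (fun s => B s - B' s) = hcat A B - hcat A' B' := by
  ext i ⟨s, j⟩
  refine Fin.cases ?_ (fun s => ?_) s <;> simp [hcat]

theorem exists_hcat_eq {m n k : ℕ} (D : Matrix (Fin m) (Fin (k + 1) × Fin n) ℂ) :
    ∃ (A : Matrix (Fin m) (Fin n) ℂ) (B : Fin k → Matrix (Fin m) (Fin n) ℂ), hcat A B = D := by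
  refine ⟨of fun i j => D i (0, j), fun s => of fun i j => D i (s.succ, j), ?_⟩
  ext i ⟨s, j⟩
  refine Fin.cases ?_ (fun s => ?_) s <;> simp [hcat]

theorem one_add_sum_norm_sq_pos {k : ℕ} (lam : Fin k → ℂ) : 0 < 1 + ∑ s, ‖lam s‖ ^ 2 :=
  add_pos_of_pos_of_nonneg one_pos (Finset.sum_nonneg fun _ _ => sq_nonneg _)

/-- Lower bound for the perturbation making `x` an eigenvector of the pencil. -/
theorem residual_div_le_frobSq {m n k : ℕ} (A Ah : Matrix (Fin m) (Fin n) ℂ)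
    (B Bh : Fin k → Matrix (Fin m) (Fin n) ℂ) (lam : Fin k → ℂ) (x : Fin n → ℂ)
    (hx : vecNormSq x = 1) (h : Ah *ᵥ x = ∑ s, lam s • Bh s *ᵥ x) :
    vecNormSq (A *ᵥ x - ∑ s, lam s • B s *ᵥ x) / (1 + ∑ s, ‖lam s‖ ^ 2) ≤
      frobSq (hcat (Ah - A) (fun s => Bh s - B s)) := by
  rw [div_le_iff₀ (one_add_sum_norm_sq_pos lam)]
  have key := vecNormSq_mulVec_le (hcat (Ah - A) (fun s => Bh s - B s)) (pencilVec lam x)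
  rwa [vecNormSq_pencilVec, hx, mul_one, hcat_sub, Matrix.sub_mulVec, hcat_mulVec_pencilVec,
    hcat_mulVec_pencilVec, h, sub_self, zero_sub, vecNormSq_neg, ← hcat_sub] at key

/-- The lower bound `residual_div_le_frobSq` is attained by a rank-one perturbation. -/
theorem exists_frobSq_eq_residual_div {m n k : ℕ} (A : Matrix (Fin m) (Fin n) ℂ)
    (B : Fin k → Matrix (Fin m) (Fin n) ℂ) (lam : Fin k → ℂ) (x : Fin n → ℂ)
    (hx : vecNormSq x = 1) :
    ∃ (Ah : Matrix (Fin m) (Fin n) ℂ) (Bh : Fin k → Matrix (Fin m) (Fin n) ℂ),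
      Ah *ᵥ x = ∑ s, lam s • Bh s *ᵥ x ∧
      frobSq (hcat (Ah - A) (fun s => Bh s - B s)) =
        vecNormSq (A *ᵥ x - ∑ s, lam s • B s *ᵥ x) / (1 + ∑ s, ‖lam s‖ ^ 2) := by
  set r := A *ᵥ x - ∑ s, lam s • B s *ᵥ x with hr
  have hN := one_add_sum_norm_sq_pos lam
  have hw : vecNormSq (pencilVec lam x) = 1 + ∑ s, ‖lam s‖ ^ 2 := by
    rw [vecNormSq_pencilVec, hx, mul_one]
  set N := 1 + ∑ s, ‖lam s‖ ^ 2
  set D := (-(N : ℂ)⁻¹) • vecMulVec r (star (pencilVec lam x)) with hD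
  obtain ⟨Ah, Bh, hAB⟩ := exists_hcat_eq (hcat A B + D)
  refine ⟨Ah, Bh, ?_, ?_⟩
  · have hN' : (N : ℂ) ≠ 0 := by exact_mod_cast hN.ne'
    rw [← sub_eq_zero, ← hcat_mulVec_pencilVec, hAB, Matrix.add_mulVec, hcat_mulVec_pencilVec,
      ← hr, hD, smul_vecMulVec_star_mulVec, hw, neg_mul, inv_mul_cancel₀ hN', neg_one_smul,
      add_neg_cancel]
  · rw [hcat_sub, hAB, add_sub_cancel_left, hD, frobSq_smul_vecMulVec_star, hw, norm_neg,
      norm_inv, Complex.norm_real, Real.norm_of_nonneg hN.le]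
    field_simp

/-- Theorem 4.1: `θ₁` equals the infimum, over eigenvalue parameters `λ` and unit
vectors `x i`, of `(∑ i ‖A i x i − ∑ s λ s • B i s x i‖²) / (1 + ∑ s |λ s|²)`. -/
theorem stmt0 (k : ℕ) (hk : 1 ≤ k) (m n : Fin k → ℕ)
    (A : ∀ i, Matrix (Fin (m i)) (Fin (n i)) ℂ)
    (B : ∀ i, Fin k → Matrix (Fin (m i)) (Fin (n i)) ℂ) :
    sInf {t : ℝ |
      ∃ (Ah : ∀ i, Matrix (Fin (m i)) (Fin (n i)) ℂ)
        (Bh : ∀ i, Fin k → Matrix (Fin (m i)) (Fin (n i)) ℂ)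
        (lam : Fin k → ℂ) (x : ∀ i, Fin (n i) → ℂ),
        (∀ i, vecNormSq (x i) = 1) ∧
        (∀ i, (Ah i).mulVec (x i) = ∑ s, lam s • (Bh i s).mulVec (x i)) ∧
        t = ∑ i, frobSq (hcat (Ah i - A i) (fun s => Bh i s - B i s))} =
    sInf {t : ℝ |
      ∃ (lam : Fin k → ℂ) (x : ∀ i, Fin (n i) → ℂ),
        (∀ i, vecNormSq (x i) = 1) ∧
        t = (∑ i, vecNormSq
              ((A i).mulVec (x i) - ∑ s, lam s • (B i s).mulVec (x i))) /
            (1 + ∑ s, ‖lam s‖ ^ 2)} := by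
  refine le_antisymm ?_ ?_
  · rcases Set.eq_empty_or_nonempty {t : ℝ |
      ∃ (lam : Fin k → ℂ) (x : ∀ i, Fin (n i) → ℂ),
        (∀ i, vecNormSq (x i) = 1) ∧
        t = (∑ i, vecNormSq
              ((A i).mulVec (x i) - ∑ s, lam s • (B i s).mulVec (x i))) /
            (1 + ∑ s, ‖lam s‖ ^ 2)} with hS | hS
    · rw [hS, Real.sInf_empty]
      refine (congrArg sInf (Set.eq_empty_of_forall_notMem ?_)).trans Real.sInf_empty |>.le
      rintro t ⟨-, -, lam, x, hx, -, -⟩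
      exact Set.eq_empty_iff_forall_notMem.mp hS _ ⟨lam, x, hx, rfl⟩
    · refine csInf_le_csInf ⟨0, ?_⟩ hS ?_
      · rintro t ⟨Ah, Bh, lam, x, -, -, rfl⟩
        exact Finset.sum_nonneg fun _ _ => frobSq_nonneg _
      · rintro t ⟨lam, x, hx, rfl⟩
        choose Ah Bh h hf using fun i =>
          exists_frobSq_eq_residual_div (A i) (B i) lam (x i) (hx i)
        exact ⟨Ah, Bh, lam, x, hx, h, by rw [Finset.sum_div]; simp only [hf]⟩
  · rcases Set.eq_empty_or_nonempty {t : ℝ |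
      ∃ (Ah : ∀ i, Matrix (Fin (m i)) (Fin (n i)) ℂ)
        (Bh : ∀ i, Fin k → Matrix (Fin (m i)) (Fin (n i)) ℂ)
        (lam : Fin k → ℂ) (x : ∀ i, Fin (n i) → ℂ),
        (∀ i, vecNormSq (x i) = 1) ∧
        (∀ i, (Ah i).mulVec (x i) = ∑ s, lam s • (Bh i s).mulVec (x i)) ∧
        t = ∑ i, frobSq (hcat (Ah i - A i) (fun s => Bh i s - B i s))} with hS | hS
    · rw [hS, Real.sInf_empty]
      refine (congrArg sInf (Set.eq_empty_of_forall_notMem ?_)).trans Real.sInf_empty |>.le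
      rintro t ⟨lam, x, hx, -⟩
      choose Ah Bh h hf using fun i =>
        exists_frobSq_eq_residual_div (A i) (B i) lam (x i) (hx i)
      exact Set.eq_empty_iff_forall_notMem.mp hS _ ⟨Ah, Bh, lam, x, hx, h, rfl⟩
    · refine le_csInf hS ?_
      rintro t ⟨Ah, Bh, lam, x, hx, h, rfl⟩
      refine csInf_le_of_le ⟨0, ?_⟩ ⟨lam, x, hx, rfl⟩ ?_
      · rintro t ⟨lam, x, -, rfl⟩
        exact div_nonneg (Finset.sum_nonneg fun _ _ => vecNormSq_nonneg _)
          (one_add_sum_norm_sq_pos lam).le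
      · rw [Finset.sum_div]
        exact Finset.sum_le_sum fun i _ =>
          residual_div_le_frobSq (A i) (Ah i) (B i) (Bh i) lam (x i) (hx i) (h i)

end
end

section
/- Let A, B_1, …, B_k ∈ ℂ^{m×n}, set m̃ = min(m, (k+1)n), and let [A, B_1, …, B_k] = U Σ Vᴴ be an SVD as in the context, with blocks U_1, Σ_1, and V_{s,1} (1 ≤ s ≤ k+1). Assume ‖V_{1,1}‖₂ < 1. Then the matrices Â = U_1 Σ_1 (V_{1,1})ᴴ and B̂_s = U_1 Σ_1 (V_{s+1,1})ᴴ (1 ≤ s ≤ k) satisfy: (i) rank([Â, B̂_1, …, B̂_k]) ≤ n; (ii) there exist X_1, …, X_k ∈ ℂ^{n×n} with Â = B̂_1 X_1 + ⋯ + B̂_k X_k; and (iii) ‖[Â − A, B̂_1 − B_1, …, B̂_k − B_k]‖_F² = Σ_{j=n+1}^{m̃} σ_j², where σ_j are the diagonal entries of Σ. Hence the infimum Σ_{j=n+1}^{m̃} σ_j² of the constrained perturbation problem is attained at these matrices. -/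
open scoped BigOperators
open Matrix

noncomputable section

/-- Spectral norm (largest singular value) of a complex matrix. -/
def specNorm {α β : Type} [Fintype α] [Fintype β] (M : Matrix α β ℂ) : ℝ :=
  sSup {r : ℝ | ∃ x : β → ℂ, vecNormSq x = 1 ∧ r = Real.sqrt (vecNormSq (M.mulVec x))}

/-- The rectangular "diagonal" matrix of an SVD of `[A, B 1, …, B k]`. -/
def svdSigma (m n k : ℕ) (σ : Fin (min m ((k + 1) * n)) → ℝ) :
    Matrix (Fin (min m ((k + 1) * n))) (Fin (k + 1) × Fin n) ℂ :=
  Matrix.of fun i p =>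
    if (i : ℕ) = (p.1 : ℕ) * n + (p.2 : ℕ) then ((σ i : ℝ) : ℂ) else 0

/-- The `n × n` block `V_{s,1}` of `V`, consisting of rows `(s−1)n+1, …, sn`
and columns `1, …, n`. -/
def Vblk {n k : ℕ} (V : Matrix (Fin (k + 1) × Fin n) (Fin (k + 1) × Fin n) ℂ)
    (s : Fin (k + 1)) : Matrix (Fin n) (Fin n) ℂ :=
  Matrix.of fun a b => V (s, a) ((0 : Fin (k + 1)), b)

theorem vecNormSq_eq_star_dotProduct {α : Type} [Fintype α] (x : α → ℂ) :
    ((vecNormSq x : ℝ) : ℂ) = star x ⬝ᵥ x := by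
  simp [vecNormSq, dotProduct, Complex.conj_mul']

theorem frobSq_eq_trace {α β : Type} [Fintype α] [Fintype β] (M : Matrix α β ℂ) :
    ((frobSq M : ℝ) : ℂ) = (Mᴴ * M).trace := by
  simp only [frobSq, trace, diag_apply, mul_apply, conjTranspose_apply, Complex.star_def,
    Complex.conj_mul', Complex.ofReal_sum, Complex.ofReal_pow]
  exact Finset.sum_comm

/-- The squared Frobenius norm is invariant under multiplication by an isometry on the left and
the adjoint of an isometry on the right. -/
theorem frobSq_isometry_mul_mul {α β γ δ : Type} [Fintype α] [Fintype β] [Fintype γ] [Fintype δ]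
    [DecidableEq β] [DecidableEq γ] {U : Matrix α β ℂ} {V : Matrix δ γ ℂ}
    (hU : Uᴴ * U = 1) (hV : Vᴴ * V = 1) (D : Matrix β γ ℂ) :
    frobSq (U * D * Vᴴ) = frobSq D := by
  have h : (U * D * Vᴴ)ᴴ * (U * D * Vᴴ) = V * (Dᴴ * D * Vᴴ) := by
    calc (U * D * Vᴴ)ᴴ * (U * D * Vᴴ) = V * (Dᴴ * (Uᴴ * U) * D * Vᴴ) := by
          simp only [conjTranspose_mul, conjTranspose_conjTranspose, Matrix.mul_assoc]
      _ = _ := by rw [hU, Matrix.mul_one]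
  apply Complex.ofReal_injective
  rw [frobSq_eq_trace, frobSq_eq_trace, h, trace_mul_comm, Matrix.mul_assoc, hV, Matrix.mul_one]

theorem vecNormSq_pos {α : Type} [Fintype α] {x : α → ℂ} (hx : x ≠ 0) : 0 < vecNormSq x := by
  obtain ⟨i, hi⟩ := Function.ne_iff.mp hx
  exact Finset.sum_pos' (fun _ _ => sq_nonneg _)
    ⟨i, Finset.mem_univ i, pow_pos (norm_pos_iff.mpr hi) 2⟩

theorem vecNormSq_smul {α : Type} [Fintype α] (c : ℂ) (x : α → ℂ) :
    vecNormSq (c • x) = ‖c‖ ^ 2 * vecNormSq x := by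
  simp [vecNormSq, mul_pow, Finset.mul_sum]

/-- A contraction of spectral norm less than one preserves the length of no nonzero vector. -/
theorem vecNormSq_mulVec_ne {α β : Type} [Fintype α] [Fintype β] {M : Matrix α β ℂ}
    (hM : ∀ x, vecNormSq (M *ᵥ x) ≤ vecNormSq x) (hspec : specNorm M < 1)
    {x : β → ℂ} (hx : x ≠ 0) : vecNormSq (M *ᵥ x) ≠ vecNormSq x := by
  intro h
  have hpos := vecNormSq_pos hx
  set c : ℂ := (((Real.sqrt (vecNormSq x))⁻¹ : ℝ) : ℂ) with hc
  have hnorm : ‖c‖ ^ 2 * vecNormSq x = 1 := by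
    rw [hc, Complex.norm_real, Real.norm_eq_abs, sq_abs, inv_pow, Real.sq_sqrt hpos.le,
      inv_mul_cancel₀ hpos.ne']
  refine hspec.not_ge (le_csSup ⟨1, ?_⟩ ⟨c • x, ?_, ?_⟩)
  · rintro r ⟨y, hy, rfl⟩
    exact Real.sqrt_le_one.mpr (hy ▸ hM y)
  · rw [vecNormSq_smul, hnorm]
  · rw [mulVec_smul, vecNormSq_smul, h, hnorm, Real.sqrt_one]

theorem sum_conjTranspose_Vblk_mul {n k : ℕ}
    {V : Matrix (Fin (k + 1) × Fin n) (Fin (k + 1) × Fin n) ℂ} (hV : Vᴴ * V = 1) :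
    ∑ s, (Vblk V s)ᴴ * Vblk V s = 1 := by
  ext a b
  have h := congrFun (congrFun hV (0, a)) (0, b)
  simpa [mul_apply, Matrix.sum_apply, Fintype.sum_prod_type, Vblk, one_apply] using h

theorem sum_vecNormSq_Vblk_mulVec {n k : ℕ}
    {V : Matrix (Fin (k + 1) × Fin n) (Fin (k + 1) × Fin n) ℂ} (hV : Vᴴ * V = 1)
    (x : Fin n → ℂ) : ∑ s, vecNormSq (Vblk V s *ᵥ x) = vecNormSq x := by
  apply Complex.ofReal_injective
  rw [Complex.ofReal_sum]
  simp only [vecNormSq_eq_star_dotProduct, star_mulVec, ← dotProduct_mulVec, mulVec_mulVec]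
  rw [← dotProduct_sum, ← sum_mulVec, sum_conjTranspose_Vblk_mul hV, one_mulVec]

/-- If the top block of an isometry has spectral norm less than one, then the Gram matrix of the
remaining blocks is invertible. -/
theorem isUnit_det_sum_conjTranspose_Vblk_mul {n k : ℕ}
    {V : Matrix (Fin (k + 1) × Fin n) (Fin (k + 1) × Fin n) ℂ} (hV : Vᴴ * V = 1)
    (hspec : specNorm (Vblk V 0) < 1) :
    IsUnit (∑ s : Fin k, (Vblk V s.succ)ᴴ * Vblk V s.succ).det := by
  have hsum := sum_vecNormSq_Vblk_mulVec hV
  rw [isUnit_iff_ne_zero]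
  intro hdet
  obtain ⟨x, hx, hNx⟩ := exists_mulVec_eq_zero_iff.mpr hdet
  refine vecNormSq_mulVec_ne (fun y => ?_) hspec hx ?_
  · rw [← hsum y]
    exact Finset.single_le_sum (f := fun s => vecNormSq (Vblk V s *ᵥ y))
      (fun _ _ => vecNormSq_nonneg _) (Finset.mem_univ 0)
  · have h := sum_conjTranspose_Vblk_mul hV
    rw [Fin.sum_univ_succ] at h
    have h' := congrArg (· *ᵥ x) h
    simp only [add_mulVec, hNx, add_zero, one_mulVec] at h'
    apply Complex.ofReal_injective
    rw [vecNormSq_eq_star_dotProduct, vecNormSq_eq_star_dotProduct, star_mulVec,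
      ← dotProduct_mulVec, mulVec_mulVec, h']

theorem hcat_mul_conjTranspose_Vblk {m n k : ℕ} (P : Matrix (Fin m) (Fin n) ℂ)
    (V : Matrix (Fin (k + 1) × Fin n) (Fin (k + 1) × Fin n) ℂ) :
    hcat (P * (Vblk V 0)ᴴ) (fun s => P * (Vblk V s.succ)ᴴ) =
      P * (V.submatrix id (Prod.mk 0))ᴴ := by
  ext i ⟨s, j⟩
  cases s using Fin.cases <;> simp [hcat, mul_apply, Vblk]

/-- The leading `n × n` block of `svdSigma`, as a product with coordinate embeddings. -/
theorem svdSigma_leading_block {m n k : ℕ} (hmn : n ≤ min m ((k + 1) * n))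
    (σ : Fin (min m ((k + 1) * n)) → ℝ) :
    (1 : Matrix (Fin (min m ((k + 1) * n))) (Fin (min m ((k + 1) * n))) ℂ).submatrix id
          (Fin.castLE hmn) * diagonal (fun j => ((σ (Fin.castLE hmn j) : ℝ) : ℂ)) *
        ((1 : Matrix (Fin (k + 1) × Fin n) (Fin (k + 1) × Fin n) ℂ).submatrix id
          (Prod.mk 0))ᴴ =
      svdSigma m n k (fun j => if n ≤ (j : ℕ) then 0 else σ j) := by
  ext i ⟨s, j⟩
  rw [mul_apply]
  simp only [mul_diagonal, submatrix_apply, conjTranspose_apply, one_apply, id,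
    Prod.mk.injEq, svdSigma, of_apply]
  rw [Finset.sum_eq_single j]
  · have hj := j.isLt
    by_cases hs : s = 0
    · subst hs
      by_cases hi : i = Fin.castLE hmn j
      · subst hi
        simp
      · have hi' : (i : ℕ) ≠ j := fun h => hi (Fin.ext h)
        simp [hi, hi']
    · have hs' : n ≤ (s : ℕ) * n :=
        Nat.le_mul_of_pos_left n (Nat.pos_of_ne_zero fun h => hs (Fin.ext h))
      by_cases hi : (i : ℕ) = (s : ℕ) * n + j
      · have : n ≤ (i : ℕ) := by omega
        simp [hs, this]
      · simp [hs, hi]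
  · intro b _ hb
    simp [hb.symm]
  · simp

theorem frobSq_svdSigma {m n k : ℕ} (σ : Fin (min m ((k + 1) * n)) → ℝ) :
    frobSq (svdSigma m n k σ) = ∑ j, σ j ^ 2 := by
  refine Finset.sum_congr rfl fun i _ => ?_
  have hi : (i : ℕ) < (k + 1) * n := i.isLt.trans_le (min_le_right _ _)
  have key : ∀ p : Fin (k + 1) × Fin n,
      (i : ℕ) = (p.1 : ℕ) * n + (p.2 : ℕ) ↔ p = finProdFinEquiv.symm ⟨i, hi⟩ := by
    intro p
    rw [Equiv.eq_symm_apply, Fin.ext_iff, finProdFinEquiv_apply_val, mul_comm n, add_comm (p.2 : ℕ),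
      eq_comm]
  simp only [svdSigma, of_apply, key]
  rw [Finset.sum_eq_single (finProdFinEquiv.symm ⟨i, hi⟩)]
  · simp
  · intro p _ hp
    rw [if_neg hp]
    simp
  · simp

/-- Lemma 5.1 (attainment): with `‖V₁₁‖₂ < 1`, the truncated-SVD matrices
`Â = U₁ S₁ V₁₁ᴴ`, `B̂ s = U₁ S₁ V_{s+1,1}ᴴ` have `rank [Â, B̂₁, …, B̂ₖ] ≤ n`,
satisfy `Â = ∑ s B̂ s X s` for some `X s`, and their distance to
`[A, B₁, …, Bₖ]` is exactly `∑_{j=n+1}^{m̃} σ_j²`; hence the infimum is attained. -/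
theorem stmt5 (m n k : ℕ)
    (A : Matrix (Fin m) (Fin n) ℂ) (B : Fin k → Matrix (Fin m) (Fin n) ℂ)
    (hmn : n ≤ min m ((k + 1) * n))
    (U : Matrix (Fin m) (Fin (min m ((k + 1) * n))) ℂ)
    (σ : Fin (min m ((k + 1) * n)) → ℝ)
    (V : Matrix (Fin (k + 1) × Fin n) (Fin (k + 1) × Fin n) ℂ)
    (hU : Uᴴ * U = 1) (hV : Vᴴ * V = 1)
    (hσ0 : ∀ j, 0 ≤ σ j) (hσm : ∀ i j, i ≤ j → σ j ≤ σ i)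
    (hSVD : hcat A B = U * svdSigma m n k σ * Vᴴ)
    (hspec : specNorm (Vblk V 0) < 1)
    (U₁ : Matrix (Fin m) (Fin n) ℂ)
    (hU₁ : U₁ = Matrix.of fun i j => U i (Fin.castLE hmn j))
    (S₁ : Matrix (Fin n) (Fin n) ℂ)
    (hS₁ : S₁ = Matrix.diagonal fun j => ((σ (Fin.castLE hmn j) : ℝ) : ℂ))
    (Ah : Matrix (Fin m) (Fin n) ℂ) (hAh : Ah = U₁ * S₁ * (Vblk V 0)ᴴ)
    (Bh : Fin k → Matrix (Fin m) (Fin n) ℂ)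
    (hBh : ∀ s, Bh s = U₁ * S₁ * (Vblk V s.succ)ᴴ) :
    (hcat Ah Bh).rank ≤ n ∧
    (∃ X : Fin k → Matrix (Fin n) (Fin n) ℂ, Ah = ∑ s, Bh s * X s) ∧
    frobSq (hcat (Ah - A) (fun s => Bh s - B s)) =
      ∑ j : Fin (min m ((k + 1) * n)), if n ≤ (j : ℕ) then σ j ^ 2 else 0 := by
  have hBh' : Bh = fun s => U₁ * S₁ * (Vblk V s.succ)ᴴ := funext hBh
  have hcatHat : hcat Ah Bh = U₁ * S₁ * (V.submatrix id (Prod.mk 0))ᴴ := by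
    rw [hAh, hBh', hcat_mul_conjTranspose_Vblk]
  refine ⟨?_, ?_, ?_⟩
  · rw [hcatHat]
    refine (rank_mul_le_left _ _).trans ((rank_le_card_width _).trans ?_)
    rw [Fintype.card_fin]
  · refine ⟨fun s => Vblk V s.succ *
      ((∑ s : Fin k, (Vblk V s.succ)ᴴ * Vblk V s.succ)⁻¹ * (Vblk V 0)ᴴ), ?_⟩
    have h : ∀ s, Bh s * (Vblk V s.succ *
        ((∑ s : Fin k, (Vblk V s.succ)ᴴ * Vblk V s.succ)⁻¹ * (Vblk V 0)ᴴ)) =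
        U₁ * S₁ * ((Vblk V s.succ)ᴴ * Vblk V s.succ) *
        ((∑ s : Fin k, (Vblk V s.succ)ᴴ * Vblk V s.succ)⁻¹ * (Vblk V 0)ᴴ) := by
      intro s
      rw [hBh]
      simp only [Matrix.mul_assoc]
    rw [Finset.sum_congr rfl fun s _ => h s, ← Matrix.sum_mul, ← Matrix.mul_sum, Matrix.mul_assoc,
      mul_nonsing_inv_cancel_left _ _ (isUnit_det_sum_conjTranspose_Vblk_mul hV hspec), hAh]
  · have hU₁' : U₁ = U *
        (1 : Matrix (Fin (min m ((k + 1) * n))) (Fin (min m ((k + 1) * n))) ℂ).submatrix id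
          (Fin.castLE hmn) := by
      rw [hU₁]
      ext i j
      simp [mul_apply, one_apply]
    have hV₁ : V.submatrix id (Prod.mk 0) =
        V * (1 : Matrix (Fin (k + 1) × Fin n) (Fin (k + 1) × Fin n) ℂ).submatrix id
          (Prod.mk 0) := by
      ext i j
      simp [mul_apply, one_apply]
    have hdiff : svdSigma m n k (fun j => if n ≤ (j : ℕ) then 0 else σ j) - svdSigma m n k σ =
        svdSigma m n k (fun j => if n ≤ (j : ℕ) then -σ j else 0) := by
      ext i p
      simp only [svdSigma, Matrix.sub_apply, of_apply]
      split_ifs <;> simp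
    have hfact : hcat (Ah - A) (fun s => Bh s - B s) =
        U * svdSigma m n k (fun j => if n ≤ (j : ℕ) then -σ j else 0) * Vᴴ := by
      rw [hcat_sub, hcatHat, hSVD, ← hdiff, ← svdSigma_leading_block hmn, hU₁', hS₁, hV₁,
        conjTranspose_mul]
      simp only [Matrix.mul_sub, Matrix.sub_mul, Matrix.mul_assoc]
    rw [hfact, frobSq_isometry_mul_mul hU hV, frobSq_svdSigma]
    refine Finset.sum_congr rfl fun j _ => ?_
    split_ifs <;> simp

end
end

section
/- Let k ≥ 1 and let A_i, B_{i1}, …, B_{ik} ∈ ℂ^{m_i×n_i} for 1 ≤ i ≤ k. Then θ̃_N ≥ φ, where θ̃_N and φ are the infima of the two constrained perturbation problems defined in the context. -/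
open scoped BigOperators
open Matrix

noncomputable section

/-- A matrix of rank at most `n` factors through `n` coordinates. -/
theorem exists_eq_mul_of_rank_le {K α β : Type*} [Field K] [Fintype α] [Fintype β] {n : ℕ}
    (M : Matrix α β K) (hM : M.rank ≤ n) :
    ∃ (C : Matrix α (Fin n) K) (D : Matrix (Fin n) β K), M = C * D := by
  classical
  have hfin : Module.finrank K (LinearMap.range M.mulVecLin) ≤ Module.finrank K (Fin n → K) := by
    simpa [Matrix.rank] using hM
  obtain ⟨f, hf⟩ := finrank_le_iff_exists_linearMap.1 hfin
  obtain ⟨g, hg⟩ := f.exists_leftInverse_of_injective (LinearMap.ker_eq_bot.2 hf)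
  refine ⟨LinearMap.toMatrix' ((LinearMap.range M.mulVecLin).subtype ∘ₗ g),
    LinearMap.toMatrix' (f ∘ₗ M.mulVecLin.rangeRestrict), ?_⟩
  rw [← LinearMap.toMatrix'_comp, LinearMap.comp_assoc, ← LinearMap.comp_assoc _ f g, hg,
    LinearMap.id_comp]
  exact (LinearMap.toMatrix'_toLin' M).symm

theorem eventually_isUnit_det_add_smul_one {n : ℕ} (Y : Matrix (Fin n) (Fin n) ℂ) :
    ∀ᶠ ε : ℂ in nhdsWithin 0 {0}ᶜ, IsUnit (Y + ε • (1 : Matrix (Fin n) (Fin n) ℂ)).det := by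
  have hne : (-Y).charpoly ≠ 0 := (Matrix.charpoly_monic _).ne_zero
  have hfin : Set.Finite {ε : ℂ | (-Y).charpoly.IsRoot ε} :=
    Polynomial.finite_setOfPred_isRoot hne
  have hmem : ({ε : ℂ | (-Y).charpoly.IsRoot ε} \ {0})ᶜ ∈ nhds (0 : ℂ) :=
    (hfin.subset Set.sdiff_subset).isClosed.isOpen_compl.mem_nhds (by simp)
  filter_upwards [nhdsWithin_le_nhds hmem, self_mem_nhdsWithin] with ε h1 h2
  rw [isUnit_iff_ne_zero]
  intro h
  refine h1 ⟨?_, h2⟩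
  rw [Set.mem_ofPred_eq, Polynomial.IsRoot, Matrix.eval_charpoly, ← h]
  congr 1
  rw [sub_neg_eq_add, add_comm, Matrix.scalar_apply, Matrix.smul_one_eq_diagonal]

theorem hcat_mul {m n k : ℕ} (C : Matrix (Fin m) (Fin n) ℂ) (Z : Matrix (Fin n) (Fin n) ℂ)
    (W : Fin k → Matrix (Fin n) (Fin n) ℂ) :
    hcat (C * Z) (fun s => C * W s) = C * hcat Z W := by
  ext i ⟨s, j⟩
  refine Fin.cases ?_ (fun s => ?_) s <;> simp [hcat, Matrix.mul_apply]

/-- If `[A, B]` has rank at most `n`, then its blocks share a left factor with `n` columns. -/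
theorem exists_common_factor_of_rank_hcat_le {m n k : ℕ} (A : Matrix (Fin m) (Fin n) ℂ)
    (B : Fin k → Matrix (Fin m) (Fin n) ℂ) (h : (hcat A B).rank ≤ n) :
    ∃ (C : Matrix (Fin m) (Fin n) ℂ) (Z : Matrix (Fin n) (Fin n) ℂ)
      (W : Fin k → Matrix (Fin n) (Fin n) ℂ), A = C * Z ∧ ∀ s, B s = C * W s := by
  obtain ⟨C, D, hCD⟩ := exists_eq_mul_of_rank_le _ h
  refine ⟨C, Matrix.of fun i j => D i (0, j), fun s => Matrix.of fun i j => D i (s.succ, j),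
    ?_, fun s => ?_⟩
  · ext i j
    simpa [hcat, Matrix.mul_apply] using congrFun (congrFun hCD i) (0, j)
  · ext i j
    simpa [hcat, Matrix.mul_apply] using congrFun (congrFun hCD i) (s.succ, j)

theorem continuous_frobSq {α β : Type} [Fintype α] [Fintype β] :
    Continuous (frobSq : Matrix α β ℂ → ℝ) := by
  unfold frobSq
  fun_prop

theorem continuous_hcat {m n k : ℕ} :
    Continuous fun p : Matrix (Fin m) (Fin n) ℂ × (Fin k → Matrix (Fin m) (Fin n) ℂ) =>
      hcat p.1 p.2 := by
  refine continuous_matrix fun i ⟨s, j⟩ => ?_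
  refine Fin.cases ?_ (fun s => ?_) s <;>
    simp only [hcat, Matrix.of_apply, Fin.cases_zero, Fin.cases_succ] <;> fun_prop

/-- The Kronecker products of standard basis vectors, enumerated by `e`, are independent. -/
theorem linearIndependent_prod_single {k N : ℕ} {n : Fin k → ℕ}
    (e : Fin N ≃ ((i : Fin k) → Fin (n i))) :
    LinearIndependent ℂ (fun j : Fin N => fun f : ((i : Fin k) → Fin (n i)) =>
      ∏ i, (Pi.single (e j i) 1 : Fin (n i) → ℂ) (f i)) := by
  convert (Pi.basisFun ℂ ((i : Fin k) → Fin (n i))).linearIndependent.comp e e.injective using 1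
  funext j f
  simp only [Function.comp_apply, Pi.basisFun_apply, Pi.single_apply, funext_iff]
  rw [Fintype.prod_boole]
  congr

/-- Theorem 5.3: `θ̃_N ≥ φ`, i.e. the infimum of the eigen-tuple–constrained
perturbation problem is at least that of the `Â_i = ∑ s B̂_{is} X_{is}`
constrained problem. -/
theorem stmt7 (k : ℕ) (hk : 1 ≤ k) (m n : Fin k → ℕ)
    (N : ℕ) (hN : N = ∏ i, n i)
    (A : ∀ i, Matrix (Fin (m i)) (Fin (n i)) ℂ)
    (B : ∀ i, Fin k → Matrix (Fin (m i)) (Fin (n i)) ℂ) :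
    sInf {t : ℝ |
      ∃ (Ah : ∀ i, Matrix (Fin (m i)) (Fin (n i)) ℂ)
        (Bh : ∀ i, Fin k → Matrix (Fin (m i)) (Fin (n i)) ℂ)
        (X : ∀ i, Fin k → Matrix (Fin (n i)) (Fin (n i)) ℂ),
        (∀ i, Ah i = ∑ s, Bh i s * X i s) ∧
        (∀ i, (hcat (Ah i) (Bh i)).rank ≤ n i) ∧
        t = ∑ i, frobSq (hcat (Ah i - A i) (fun s => Bh i s - B i s))} ≤
    sInf {t : ℝ |
      ∃ (Ah : ∀ i, Matrix (Fin (m i)) (Fin (n i)) ℂ)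
        (Bh : ∀ i, Fin k → Matrix (Fin (m i)) (Fin (n i)) ℂ)
        (lam : Fin k → Fin N → ℂ)
        (x : (i : Fin k) → Fin N → Fin (n i) → ℂ),
        (∀ i j, (Ah i).mulVec (x i j) = ∑ s, lam s j • (Bh i s).mulVec (x i j)) ∧
        LinearIndependent ℂ
          (fun j : Fin N => fun f : ((i : Fin k) → Fin (n i)) => ∏ i, x i j (f i)) ∧
        (∀ i, (hcat (Ah i) (Bh i)).rank ≤ n i) ∧
        t = ∑ i, frobSq (hcat (Ah i - A i) (fun s => Bh i s - B i s))} := by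
  apply le_csInf
  · let e : Fin N ≃ ((i : Fin k) → Fin (n i)) := (finCongr hN).trans finPiFinEquiv.symm
    refine ⟨_, fun _ => 0, fun _ _ => 0, fun _ _ => 0, fun i j => Pi.single (e j i) 1, ?_,
      linearIndependent_prod_single e, fun i => ?_, rfl⟩
    · intro i j
      simp only [Matrix.zero_mulVec, smul_zero, Finset.sum_const_zero]
    · have h0 := hcat_mul (0 : Matrix (Fin (m i)) (Fin (n i)) ℂ) 0 fun _ : Fin k => 0
      simp only [Matrix.zero_mul] at h0
      simp [h0]
  · rintro t ⟨Ah, Bh, -, -, -, -, hrank, rfl⟩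
    choose C Z W hZ hW using fun i => exists_common_factor_of_rank_hcat_le _ _ (hrank i)
    let s₀ : Fin k := ⟨0, hk⟩
    let V (ε : ℂ) (i : Fin k) (s : Fin k) : Matrix (Fin (n i)) (Fin (n i)) ℂ :=
      W i s + if s = s₀ then ε • 1 else 0
    have hV : ∀ i s, Continuous fun ε => V ε i s := by
      intro i s
      by_cases h : s = s₀
      · simp only [V, if_pos h]
        fun_prop
      · simp only [V, if_neg h]
        fun_prop
    have hcont : Continuous fun ε : ℂ =>
        ∑ i, frobSq (hcat (Ah i - A i) (fun s => C i * V ε i s - B i s)) := by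
      refine continuous_finsetSum _ fun i _ => continuous_frobSq.comp
        (continuous_hcat.comp (continuous_const.prodMk (continuous_pi fun s => ?_)))
      exact (continuous_const.matrix_mul (hV i s)).sub continuous_const
    have hlim := (hcont.tendsto 0).mono_left (nhdsWithin_le_nhds (s := {0}ᶜ))
    have hzero : ∀ i s, C i * V 0 i s = Bh i s := by
      intro i s
      simp [V, hW]
    simp only [hzero] at hlim
    refine ge_of_tendsto hlim ?_
    filter_upwards [Filter.eventually_all.2 fun i =>
      eventually_isUnit_det_add_smul_one (W i s₀)] with ε hε
    refine csInf_le ⟨0, ?_⟩ ⟨Ah, fun i s => C i * V ε i s,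
      fun i s => if s = s₀ then (V ε i s₀)⁻¹ * Z i else 0, fun i => ?_, fun i => ?_, rfl⟩
    · rintro _ ⟨_, _, _, _, _, rfl⟩
      exact Finset.sum_nonneg fun i _ => frobSq_nonneg _
    · have hu : IsUnit (V ε i s₀).det := by simpa [V] using hε i
      rw [Finset.sum_eq_single s₀ (fun s _ hs => by simp [hs]) (by simp)]
      dsimp only
      rw [if_pos rfl, Matrix.mul_assoc, Matrix.mul_nonsing_inv_cancel_left _ _ hu, hZ]
    · rw [hZ, hcat_mul]
      exact (Matrix.rank_mul_le_left _ _).trans (by simpa using Matrix.rank_le_width (C i))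

end
end

section
/- Let k ≥ 1, let A_i, B_{i1}, …, B_{ik} ∈ ℂ^{m_i×n_i} for 1 ≤ i ≤ k, and for each i let [A_i, B_{i1}, …, B_{ik}] = U^i Σ^i (V^i)ᴴ be an SVD partitioned as in the context. Define Ã_i = (V^i_{1,1})ᴴ and B̃_{is} = (V^i_{s+1,1})ᴴ for 1 ≤ s ≤ k. Then: (a) if rank([A_i, B_{i1}, …, B_{ik}]) ≤ n_i for every i, then every tuple (λ_1, …, λ_k, x_1, …, x_k) with λ_s ∈ ℂ and nonzero x_i ∈ ℂ^{n_i} satisfying Ã_i x_i = Σ_{s=1}^k λ_s B̃_{is} x_i for all i also satisfies A_i x_i = Σ_{s=1}^k λ_s B_{is} x_i for all i; (b) if rank([A_i, B_{i1}, …, B_{ik}]) ≥ n_i for every i, then every tuple satisfying A_i x_i = Σ_{s=1}^k λ_s B_{is} x_i for all i also satisfies Ã_i x_i = Σ_{s=1}^k λ_s B̃_{is} x_i for all i; (c) if rank([A_i, B_{i1}, …, B_{ik}]) = n_i for every i, then the two systems have exactly the same solution tuples. -/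
open scoped BigOperators
open Matrix

noncomputable section

/-- The column of the concatenated matrix carrying the `i`-th singular value. -/
def svdCol (m n k : ℕ) (i : Fin (min m ((k + 1) * n))) : Fin (k + 1) × Fin n :=
  finProdFinEquiv.symm (Fin.castLE (min_le_right _ _) i)

theorem svdCol_injective (m n k : ℕ) : Function.Injective (svdCol m n k) :=
  finProdFinEquiv.symm.injective.comp (Fin.castLE_injective _)

theorem svdCol_eq_iff {m n k : ℕ} (i : Fin (min m ((k + 1) * n))) (p : Fin (k + 1) × Fin n) :
    svdCol m n k i = p ↔ (i : ℕ) = (p.1 : ℕ) * n + (p.2 : ℕ) := by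
  rw [svdCol, Equiv.symm_apply_eq, Fin.ext_iff, Fin.val_castLE, finProdFinEquiv_apply_val,
    add_comm (p.2 : ℕ), mul_comm n (p.1 : ℕ)]

theorem svdSigma_eq (m n k : ℕ) (σ : Fin (min m ((k + 1) * n)) → ℝ) :
    svdSigma m n k σ = diagonal (fun i => (σ i : ℂ)) *
      (1 : Matrix (Fin (k + 1) × Fin n) (Fin (k + 1) × Fin n) ℂ).submatrix (svdCol m n k) id := by
  ext i p
  simp [svdSigma, diagonal_mul, one_apply, svdCol_eq_iff]

theorem svdSigma_mulVec (m n k : ℕ) (σ : Fin (min m ((k + 1) * n)) → ℝ)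
    (z : Fin (k + 1) × Fin n → ℂ) (i : Fin (min m ((k + 1) * n))) :
    (svdSigma m n k σ *ᵥ z) i = σ i * z (svdCol m n k i) := by
  simp [mulVec, dotProduct, svdSigma, ← svdCol_eq_iff]

theorem rank_svdSigma (m n k : ℕ) (σ : Fin (min m ((k + 1) * n)) → ℝ) :
    (svdSigma m n k σ).rank = Fintype.card {i // σ i ≠ 0} := by
  have hP : (1 : Matrix (Fin (k + 1) × Fin n) (Fin (k + 1) × Fin n) ℂ).submatrix
        (svdCol m n k) id *
      (1 : Matrix (Fin (k + 1) × Fin n) (Fin (k + 1) × Fin n) ℂ).submatrix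
        id (svdCol m n k) = 1 := by
    rw [← submatrix_mul _ _ _ _ _ Function.bijective_id, one_mul,
      submatrix_one _ (svdCol_injective m n k)]
  have hd : (svdSigma m n k σ).rank = (diagonal (fun i => (σ i : ℂ))).rank := by
    refine le_antisymm (by rw [svdSigma_eq]; exact rank_mul_le_left _ _) ?_
    calc (diagonal (fun i => (σ i : ℂ))).rank
        = (svdSigma m n k σ *
          (1 : Matrix (Fin (k + 1) × Fin n) (Fin (k + 1) × Fin n) ℂ).submatrix
            id (svdCol m n k)).rank := by
          rw [svdSigma_eq, Matrix.mul_assoc, hP, Matrix.mul_one]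
      _ ≤ _ := rank_mul_le_left _ _
  rw [hd, rank_diagonal]
  simp

theorem Antitone.lt_card_of_ne_zero {r : ℕ} {σ : Fin r → ℝ} (h0 : ∀ j, 0 ≤ σ j)
    (hσ : Antitone σ) {j : Fin r} (hj : σ j ≠ 0) : (j : ℕ) < Fintype.card {i // σ i ≠ 0} := by
  have hsub : Finset.Iic j ⊆ Finset.univ.filter fun i => σ i ≠ 0 := fun i hi => by
    have hij := hσ (Finset.mem_Iic.1 hi)
    have hpos := lt_of_le_of_ne (h0 j) hj.symm
    simpa using (hpos.trans_le hij).ne'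
  have hcard := Finset.card_le_card hsub
  rw [Fin.card_Iic] at hcard
  rw [Fintype.card_subtype]
  omega

theorem Antitone.ne_zero_of_lt_card {r : ℕ} {σ : Fin r → ℝ} (h0 : ∀ j, 0 ≤ σ j)
    (hσ : Antitone σ) {j : Fin r} (hj : (j : ℕ) < Fintype.card {i // σ i ≠ 0}) : σ j ≠ 0 := by
  intro hz
  have hsub : (Finset.univ.filter fun i => σ i ≠ 0) ⊆ Finset.Iio j := fun i hi => by
    by_contra hij
    have hle := hσ (not_lt.1 fun h => hij (Finset.mem_Iio.2 h))
    exact (Finset.mem_filter.1 hi).2 (le_antisymm (hz ▸ hle) (h0 i))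
  have hcard := Finset.card_le_card hsub
  rw [Fin.card_Iio] at hcard
  rw [Fintype.card_subtype] at hj
  omega

/-- The vector `(x, -λ₁ x, …, -λₖ x)`. -/
def stackVec {n k : ℕ} (lam : Fin k → ℂ) (x : Fin n → ℂ) : Fin (k + 1) × Fin n → ℂ :=
  fun p => Fin.cases (x p.2) (fun s => -(lam s * x p.2)) p.1

theorem hcat_mulVec_stackVec {m n k : ℕ} (A : Matrix (Fin m) (Fin n) ℂ)
    (B : Fin k → Matrix (Fin m) (Fin n) ℂ) (lam : Fin k → ℂ) (x : Fin n → ℂ) :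
    hcat A B *ᵥ stackVec lam x = A *ᵥ x - ∑ s, lam s • (B s *ᵥ x) := by
  ext i
  simp [mulVec, dotProduct, hcat, stackVec, Fintype.sum_prod_type, Fin.sum_univ_succ,
    Finset.mul_sum, sub_eq_add_neg, mul_left_comm]

theorem conjTranspose_mulVec_stackVec {n k : ℕ}
    (V : Matrix (Fin (k + 1) × Fin n) (Fin (k + 1) × Fin n) ℂ) (lam : Fin k → ℂ)
    (x : Fin n → ℂ) (b : Fin n) :
    (Vᴴ *ᵥ stackVec lam x) (0, b) =
      ((Vblk V 0)ᴴ *ᵥ x - ∑ s : Fin k, lam s • ((Vblk V s.succ)ᴴ *ᵥ x)) b := by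
  simp [mulVec, dotProduct, Vblk, stackVec, Fintype.sum_prod_type, Fin.sum_univ_succ,
    Finset.mul_sum, sub_eq_add_neg, mul_left_comm]

section SVD

variable {m n k : ℕ} {M : Matrix (Fin m) (Fin (k + 1) × Fin n) ℂ}
  {U : Matrix (Fin m) (Fin (min m ((k + 1) * n))) ℂ} {σ : Fin (min m ((k + 1) * n)) → ℝ}
  {V : Matrix (Fin (k + 1) × Fin n) (Fin (k + 1) × Fin n) ℂ}

theorem rank_eq_card_of_svd (hU : Uᴴ * U = 1) (hV : Vᴴ * V = 1)
    (hM : M = U * svdSigma m n k σ * Vᴴ) : M.rank = Fintype.card {i // σ i ≠ 0} := by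
  rw [← rank_svdSigma]
  refine le_antisymm ?_ ?_
  · rw [hM]
    exact (rank_mul_le_left _ _).trans (rank_mul_le_right _ _)
  · have h : svdSigma m n k σ = Uᴴ * M * V := by
      rw [hM, ← Matrix.mul_assoc, ← Matrix.mul_assoc, hU, Matrix.one_mul, Matrix.mul_assoc, hV,
        Matrix.mul_one]
    calc (svdSigma m n k σ).rank = (Uᴴ * M * V).rank := by rw [← h]
      _ ≤ M.rank := (rank_mul_le_left _ _).trans (rank_mul_le_right _ _)

theorem mulVec_eq_zero_iff_of_svd (hU : Uᴴ * U = 1) (hM : M = U * svdSigma m n k σ * Vᴴ)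
    (y : Fin (k + 1) × Fin n → ℂ) :
    M *ᵥ y = 0 ↔ ∀ i, σ i ≠ 0 → (Vᴴ *ᵥ y) (svdCol m n k i) = 0 := by
  have h : M *ᵥ y = 0 ↔ svdSigma m n k σ *ᵥ (Vᴴ *ᵥ y) = 0 := by
    rw [hM, ← mulVec_mulVec, ← mulVec_mulVec]
    refine ⟨fun h => ?_, fun h => by rw [h, mulVec_zero]⟩
    rw [← one_mulVec (svdSigma m n k σ *ᵥ (Vᴴ *ᵥ y)), ← hU, ← mulVec_mulVec, h, mulVec_zero]
  simp only [h, funext_iff, svdSigma_mulVec, Pi.zero_apply, mul_eq_zero, Complex.ofReal_eq_zero,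
    or_iff_not_imp_left, ne_eq]

theorem mulVec_eq_zero_of_rank_le (hU : Uᴴ * U = 1) (hV : Vᴴ * V = 1) (h0 : ∀ j, 0 ≤ σ j)
    (hσ : Antitone σ) (hM : M = U * svdSigma m n k σ * Vᴴ) (hr : M.rank ≤ n)
    {y : Fin (k + 1) × Fin n → ℂ} (hy : ∀ b, (Vᴴ *ᵥ y) (0, b) = 0) : M *ᵥ y = 0 := by
  refine (mulVec_eq_zero_iff_of_svd hU hM y).2 fun i hi => ?_
  have hin : (i : ℕ) < n :=
    (hσ.lt_card_of_ne_zero h0 hi).trans_le (rank_eq_card_of_svd hU hV hM ▸ hr)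
  rw [(svdCol_eq_iff i (0, ⟨i, hin⟩)).2 (by simp)]
  exact hy _

theorem conjTranspose_mulVec_eq_zero_of_le_rank (hU : Uᴴ * U = 1) (hV : Vᴴ * V = 1)
    (h0 : ∀ j, 0 ≤ σ j) (hσ : Antitone σ) (hM : M = U * svdSigma m n k σ * Vᴴ)
    (hr : n ≤ M.rank) {y : Fin (k + 1) × Fin n → ℂ} (hy : M *ᵥ y = 0) (b : Fin n) :
    (Vᴴ *ᵥ y) (0, b) = 0 := by
  have hb : (b : ℕ) < Fintype.card {i // σ i ≠ 0} :=
    b.2.trans_le (rank_eq_card_of_svd hU hV hM ▸ hr)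
  have hbr : (b : ℕ) < min m ((k + 1) * n) :=
    hb.trans_le ((Fintype.card_subtype_le _).trans_eq (Fintype.card_fin _))
  have h := (mulVec_eq_zero_iff_of_svd hU hM y).1 hy ⟨b, hbr⟩ (hσ.ne_zero_of_lt_card h0 hb)
  rwa [(svdCol_eq_iff ⟨b, hbr⟩ (0, b)).2 (by simp)] at h

end SVD

/-- Theorem 5.7: relations between the solution sets of the original RMEP with
coefficients `A_i, B_{is}` and the truncated-SVD MEP with coefficients
`Ã_i = (Vⁱ₁₁)ᴴ`, `B̃_{is} = (Vⁱ_{s+1,1})ᴴ`: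
(a) if `rank [A_i, B_{i1}, …, B_{ik}] ≤ n_i` for all `i`, every MEP solution
solves the RMEP; (b) if `rank ≥ n_i` for all `i`, every RMEP solution solves
the MEP; (c) if `rank = n_i` for all `i`, the solution sets coincide. -/
theorem stmt10 (k : ℕ) (hk : 1 ≤ k) (m n : Fin k → ℕ)
    (A : ∀ i, Matrix (Fin (m i)) (Fin (n i)) ℂ)
    (B : ∀ i, Fin k → Matrix (Fin (m i)) (Fin (n i)) ℂ)
    (U : ∀ i, Matrix (Fin (m i)) (Fin (min (m i) ((k + 1) * n i))) ℂ)
    (σ : ∀ i, Fin (min (m i) ((k + 1) * n i)) → ℝ)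
    (V : ∀ i, Matrix (Fin (k + 1) × Fin (n i)) (Fin (k + 1) × Fin (n i)) ℂ)
    (hU : ∀ i, (U i)ᴴ * U i = 1) (hV : ∀ i, (V i)ᴴ * V i = 1)
    (hσ0 : ∀ i j, 0 ≤ σ i j) (hσm : ∀ i j₁ j₂, j₁ ≤ j₂ → σ i j₂ ≤ σ i j₁)
    (hSVD : ∀ i, hcat (A i) (B i) = U i * svdSigma (m i) (n i) k (σ i) * (V i)ᴴ) :
    ((∀ i, (hcat (A i) (B i)).rank ≤ n i) →
      ∀ (lam : Fin k → ℂ) (x : ∀ i, Fin (n i) → ℂ), (∀ i, x i ≠ 0) →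
        (∀ i, ((Vblk (V i) 0)ᴴ).mulVec (x i) =
            ∑ s : Fin k, lam s • (((Vblk (V i) s.succ)ᴴ).mulVec (x i))) →
        (∀ i, (A i).mulVec (x i) = ∑ s, lam s • ((B i s).mulVec (x i)))) ∧
    ((∀ i, n i ≤ (hcat (A i) (B i)).rank) →
      ∀ (lam : Fin k → ℂ) (x : ∀ i, Fin (n i) → ℂ), (∀ i, x i ≠ 0) →
        (∀ i, (A i).mulVec (x i) = ∑ s, lam s • ((B i s).mulVec (x i))) →
        (∀ i, ((Vblk (V i) 0)ᴴ).mulVec (x i) =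
            ∑ s : Fin k, lam s • (((Vblk (V i) s.succ)ᴴ).mulVec (x i)))) ∧
    ((∀ i, (hcat (A i) (B i)).rank = n i) →
      ∀ (lam : Fin k → ℂ) (x : ∀ i, Fin (n i) → ℂ), (∀ i, x i ≠ 0) →
        ((∀ i, ((Vblk (V i) 0)ᴴ).mulVec (x i) =
            ∑ s : Fin k, lam s • (((Vblk (V i) s.succ)ᴴ).mulVec (x i))) ↔
         (∀ i, (A i).mulVec (x i) = ∑ s, lam s • ((B i s).mulVec (x i))))) := by
  have hrmep : ∀ (lam : Fin k → ℂ) (x : ∀ i, Fin (n i) → ℂ) (i : Fin k),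
      (A i).mulVec (x i) = ∑ s, lam s • ((B i s).mulVec (x i)) ↔
        hcat (A i) (B i) *ᵥ stackVec lam (x i) = 0 := fun lam x i => by
    rw [hcat_mulVec_stackVec, sub_eq_zero]
  have hmep : ∀ (lam : Fin k → ℂ) (x : ∀ i, Fin (n i) → ℂ) (i : Fin k),
      ((Vblk (V i) 0)ᴴ).mulVec (x i) =
          ∑ s : Fin k, lam s • (((Vblk (V i) s.succ)ᴴ).mulVec (x i)) ↔
        ∀ b, ((V i)ᴴ *ᵥ stackVec lam (x i)) (0, b) = 0 := fun lam x i => by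
    rw [← sub_eq_zero, funext_iff]
    simp only [conjTranspose_mulVec_stackVec, Pi.zero_apply]
  simp only [hrmep, hmep]
  have ha := fun i (hr : (hcat (A i) (B i)).rank ≤ n i) (y : Fin (k + 1) × Fin (n i) → ℂ) =>
    mulVec_eq_zero_of_rank_le (y := y) (hU i) (hV i) (hσ0 i) (hσm i) (hSVD i) hr
  have hb := fun i (hr : n i ≤ (hcat (A i) (B i)).rank) (y : Fin (k + 1) × Fin (n i) → ℂ) =>
    conjTranspose_mulVec_eq_zero_of_le_rank (y := y) (hU i) (hV i) (hσ0 i) (hσm i) (hSVD i) hr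
  exact ⟨fun hr lam x _ h i => ha i (hr i) _ (h i), fun hr lam x _ h i => hb i (hr i) _ (h i),
    fun hr lam x _ => ⟨fun h i => ha i (hr i).le _ (h i), fun h i => hb i (hr i).ge _ (h i)⟩⟩

end
end
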